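/- (NaïveFairGAN-II global optimum.) Let (Ω, μ) be a measurable space with σ-finite measure μ and let p_d1, p_d0 be fixed probability density functions with respect to μ. For probability densities p_g1, p_g0 with respect to μ, define C'(p_g1, p_g0) = −6·log 2 + 4·JSD((p_d1 + p_d0)/2 ‖ (p_g1 + p_g0)/2) + 2·JSD(p_g1 ‖ p_g0). Then C'(p_g1, p_g0) ≥ −6·log 2, and the minimum −6·log 2 is attained if and only if p_g1 = p_g0 = (p_d1 + p_d0)/2 μ-almost everywhere. -/

import Mathlib

open MeasureTheory Real

/-- A probability density function with respect to a measure. -/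
def IsPDF {Ω : Type*} [MeasurableSpace Ω] (μ : Measure Ω) (p : Ω → ℝ) : Prop :=
  Measurable p ∧ (∀ x, 0 ≤ p x) ∧ ∫ x, p x ∂μ = 1

/-- Jensen–Shannon divergence between two densities w.r.t. `μ`. -/
noncomputable def JSD {Ω : Type*} [MeasurableSpace Ω] (μ : Measure Ω) (p q : Ω → ℝ) : ℝ :=
  (1 / 2) * ∫ x, p x * Real.log (2 * p x / (p x + q x)) ∂μ +
  (1 / 2) * ∫ x, q x * Real.log (2 * q x / (p x + q x)) ∂μ

theorem half_sub_le_mul_log_ratio {a b : ℝ} (ha : 0 ≤ a) (hb : 0 ≤ b) :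
    (a - b) / 2 ≤ a * Real.log (2 * a / (a + b)) := by
  rcases ha.eq_or_lt with rfl | ha
  · simp only [zero_mul]
    linarith
  · have h := mul_le_mul_of_nonneg_left
      (Real.one_sub_inv_le_log_of_pos (show 0 < 2 * a / (a + b) by positivity)) ha.le
    have e : a * (1 - (2 * a / (a + b))⁻¹) = (a - b) / 2 := by
      field_simp
      ring
    rwa [e] at h

theorem eq_of_mul_log_ratio_eq {a b : ℝ} (ha : 0 ≤ a) (hb : 0 ≤ b)
    (h : a * Real.log (2 * a / (a + b)) = (a - b) / 2) : a = b := by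
  rcases ha.eq_or_lt with rfl | ha
  · simp only [zero_mul] at h
    linarith
  · by_contra hne
    have hs : (a + b) / (2 * a) ≠ 1 := by
      intro h1
      rw [div_eq_one_iff_eq (by positivity)] at h1
      exact hne (by linarith)
    have hlt := mul_lt_mul_of_pos_left
      (Real.log_lt_sub_one_of_pos (show 0 < (a + b) / (2 * a) by positivity) hs) ha
    rw [← inv_div, Real.log_inv] at h
    have e : a * ((a + b) / (2 * a) - 1) = (b - a) / 2 := by
      field_simp
      ring
    linarith

theorem mul_log_ratio_le {a b : ℝ} (ha : 0 ≤ a) (hb : 0 ≤ b) :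
    a * Real.log (2 * a / (a + b)) ≤ a * Real.log 2 := by
  rcases ha.eq_or_lt with rfl | ha
  · simp
  · refine mul_le_mul_of_nonneg_left (Real.log_le_log (by positivity) ?_) ha.le
    rw [div_le_iff₀ (by positivity)]
    linarith

namespace IsPDF

variable {Ω : Type*} [MeasurableSpace Ω] {μ : Measure Ω} {p q : Ω → ℝ}

theorem integrable (hp : IsPDF μ p) : Integrable p μ :=
  Integrable.of_integral_ne_zero (by rw [hp.2.2]; exact one_ne_zero)

theorem midpoint (hp : IsPDF μ p) (hq : IsPDF μ q) :
    IsPDF μ (fun x => (p x + q x) / 2) := by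
  refine ⟨(hp.1.add hq.1).div_const 2,
    fun x => div_nonneg (add_nonneg (hp.2.1 x) (hq.2.1 x)) zero_le_two, ?_⟩
  rw [integral_div, integral_add hp.integrable hq.integrable, hp.2.2, hq.2.2]
  norm_num

theorem integrable_mul_log_ratio (hp : IsPDF μ p) (hq : IsPDF μ q) :
    Integrable (fun x => p x * Real.log (2 * p x / (p x + q x))) μ := by
  have hmeas : Measurable (fun x => p x * Real.log (2 * p x / (p x + q x))) :=
    hp.1.mul (((hp.1.const_mul 2).div (hp.1.add hq.1)).log)
  exact integrable_of_le_of_le hmeas.aestronglyMeasurable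
    (.of_forall fun x => half_sub_le_mul_log_ratio (hp.2.1 x) (hq.2.1 x))
    (.of_forall fun x => mul_log_ratio_le (hp.2.1 x) (hq.2.1 x))
    ((hp.integrable.sub hq.integrable).div_const 2) (hp.integrable.mul_const _)

theorem integral_half_sub (hp : IsPDF μ p) (hq : IsPDF μ q) :
    ∫ x, (p x - q x) / 2 ∂μ = 0 := by
  rw [integral_div, integral_sub hp.integrable hq.integrable, hp.2.2, hq.2.2]
  norm_num

theorem integral_mul_log_ratio_nonneg (hp : IsPDF μ p) (hq : IsPDF μ q) :
    0 ≤ ∫ x, p x * Real.log (2 * p x / (p x + q x)) ∂μ := by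
  rw [← hp.integral_half_sub hq]
  exact integral_mono ((hp.integrable.sub hq.integrable).div_const 2)
    (hp.integrable_mul_log_ratio hq)
    fun x => half_sub_le_mul_log_ratio (hp.2.1 x) (hq.2.1 x)

theorem ae_eq_of_integral_mul_log_ratio_eq_zero (hp : IsPDF μ p) (hq : IsPDF μ q)
    (h : ∫ x, p x * Real.log (2 * p x / (p x + q x)) ∂μ = 0) : p =ᵐ[μ] q := by
  have hae := (integral_eq_iff_of_ae_le ((hp.integrable.sub hq.integrable).div_const 2)
    (hp.integrable_mul_log_ratio hq)
    (.of_forall fun x => half_sub_le_mul_log_ratio (hp.2.1 x) (hq.2.1 x))).1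
    ((hp.integral_half_sub hq).trans h.symm)
  filter_upwards [hae] with x hx
  exact eq_of_mul_log_ratio_eq (hp.2.1 x) (hq.2.1 x) hx.symm

theorem JSD_eq (p q : Ω → ℝ) : JSD μ p q =
    (1 / 2) * ∫ x, p x * Real.log (2 * p x / (p x + q x)) ∂μ +
    (1 / 2) * ∫ x, q x * Real.log (2 * q x / (q x + p x)) ∂μ := by
  simp only [JSD, add_comm (q _) (p _)]

theorem JSD_nonneg (hp : IsPDF μ p) (hq : IsPDF μ q) : 0 ≤ JSD μ p q := by
  rw [JSD_eq]
  linarith [hp.integral_mul_log_ratio_nonneg hq, hq.integral_mul_log_ratio_nonneg hp]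

theorem JSD_eq_zero_iff (hp : IsPDF μ p) (hq : IsPDF μ q) : JSD μ p q = 0 ↔ p =ᵐ[μ] q := by
  constructor
  · intro h
    rw [JSD_eq] at h
    apply hp.ae_eq_of_integral_mul_log_ratio_eq_zero hq
    linarith [hp.integral_mul_log_ratio_nonneg hq, hq.integral_mul_log_ratio_nonneg hp]
  · intro h
    have key : ∀ {r s : Ω → ℝ}, r =ᵐ[μ] s →
        ∫ x, r x * Real.log (2 * r x / (r x + s x)) ∂μ = 0 := by
      intro r s hrs
      refine integral_eq_zero_of_ae ?_
      filter_upwards [hrs] with x hx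
      rcases eq_or_ne (s x) 0 with h0 | h0
      · simp [hx, h0]
      · simp [hx, ← two_mul, h0]
    rw [JSD_eq, key h, key h.symm]
    norm_num

end IsPDF

/-- NaïveFairGAN-II global optimum:
`C'(p_g1, p_g0) = −6·log 2 + 4·JSD((p_d1+p_d0)/2 ‖ (p_g1+p_g0)/2) + 2·JSD(p_g1‖p_g0)`
is at least `−6·log 2`, with the minimum attained iff
`p_g1 = p_g0 = (p_d1 + p_d0)/2` `μ`-a.e. -/
theorem naiveFairGANII_global_optimum {Ω : Type*} [MeasurableSpace Ω]
    (μ : Measure Ω) [SigmaFinite μ]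
    (pd1 pd0 pg1 pg0 : Ω → ℝ)
    (hpd1 : IsPDF μ pd1) (hpd0 : IsPDF μ pd0)
    (hpg1 : IsPDF μ pg1) (hpg0 : IsPDF μ pg0)
    (C' : ℝ)
    (hC' : C' = -6 * Real.log 2 +
        4 * JSD μ (fun x => (pd1 x + pd0 x) / 2) (fun x => (pg1 x + pg0 x) / 2) +
        2 * JSD μ pg1 pg0) :
    -6 * Real.log 2 ≤ C' ∧
    (C' = -6 * Real.log 2 ↔
      pg1 =ᵐ[μ] (fun x => (pd1 x + pd0 x) / 2) ∧
      pg0 =ᵐ[μ] (fun x => (pd1 x + pd0 x) / 2)) := by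
  subst hC'
  have hd := hpd1.midpoint hpd0
  have hg := hpg1.midpoint hpg0
  have h1 := hd.JSD_nonneg hg
  have h2 := hpg1.JSD_nonneg hpg0
  refine ⟨by linarith, fun h => ?_, fun ⟨ha, hb⟩ => ?_⟩
  · have e1 := (hd.JSD_eq_zero_iff hg).1 (by linarith)
    have e2 := (hpg1.JSD_eq_zero_iff hpg0).1 (by linarith)
    constructor
    · filter_upwards [e1, e2] with x hx hy
      linarith
    · filter_upwards [e1, e2] with x hx hy
      linarith
  · rw [(hd.JSD_eq_zero_iff hg).2 ?_, (hpg1.JSD_eq_zero_iff hpg0).2 (ha.trans hb.symm)]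
    · ring
    · filter_upwards [ha, hb] with x hx hy
      linarith
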